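/- arXiv:1607.06628 — 8 statements merged into one kernel-verified Lean document; each statement's English description precedes it below -/
import Mathlib

section
/- Let X, Y be matrices in SL(2,ℂ) satisfying the Klein bottle relation X⁻¹YX = Y⁻¹. Then, up to simultaneous conjugation by an element of SL(2,ℂ), exactly one of the following holds: (1) Y = 1 or Y = −1 (and X is arbitrary); (2) there exist C ∈ SL(2,ℂ) and η ∈ ℂ× with η ≠ ±1 such that C⁻¹YC = [[η,0],[0,η⁻¹]] and C⁻¹XC = [[0,−1],[1,0]]; (3) there exist C ∈ SL(2,ℂ), a sign ε ∈ {±1}, ω ∈ ℂ with ω ≠ 0, a sign δ ∈ {±1}, and ω′ ∈ ℂ such that C⁻¹YC = [[ε,ω],[0,ε]] and C⁻¹XC = [[δ√−1, ω′],[0, −δ√−1]]. -/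
open Matrix Complex

abbrev SL2 := Matrix.SpecialLinearGroup (Fin 2) ℂ

/-- Case (1): abelian case, `Y = ±1`. -/
def KbCase1 (_X Y : SL2) : Prop := Y = 1 ∨ Y = -1

/-- Case (2): irreducible case. -/
def KbCase2 (X Y : SL2) : Prop :=
  ∃ (C : SL2) (η : ℂ), η ≠ 0 ∧ η ≠ 1 ∧ η ≠ -1 ∧
    ((C⁻¹ * Y * C : SL2) : Matrix (Fin 2) (Fin 2) ℂ) = !![η, 0; 0, η⁻¹] ∧
    ((C⁻¹ * X * C : SL2) : Matrix (Fin 2) (Fin 2) ℂ) = !![0, -1; 1, 0]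

/-- Case (3): reducible non-abelian case. -/
def KbCase3 (X Y : SL2) : Prop :=
  ∃ (C : SL2) (ε : ℂ) (ω : ℂ) (δ : ℂ) (ω' : ℂ),
    (ε = 1 ∨ ε = -1) ∧ ω ≠ 0 ∧ (δ = 1 ∨ δ = -1) ∧
    ((C⁻¹ * Y * C : SL2) : Matrix (Fin 2) (Fin 2) ℂ) = !![ε, ω; 0, ε] ∧
    ((C⁻¹ * X * C : SL2) : Matrix (Fin 2) (Fin 2) ℂ) =
      !![δ * Complex.I, ω'; 0, -δ * Complex.I]

namespace KbRep

lemma coe_conj_eq_iff (C Y : SL2) (M : Matrix (Fin 2) (Fin 2) ℂ) :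
    ((C⁻¹ * Y * C : SL2) : Matrix (Fin 2) (Fin 2) ℂ) = M ↔
      (Y : Matrix (Fin 2) (Fin 2) ℂ) * C = C * M := by
  have h₁ : (C : Matrix (Fin 2) (Fin 2) ℂ) * (C⁻¹ : SL2) = 1 := by
    rw [← Matrix.SpecialLinearGroup.coe_mul, mul_inv_cancel, Matrix.SpecialLinearGroup.coe_one]
  have h₂ : ((C⁻¹ : SL2) : Matrix (Fin 2) (Fin 2) ℂ) * C = 1 := by
    rw [← Matrix.SpecialLinearGroup.coe_mul, inv_mul_cancel, Matrix.SpecialLinearGroup.coe_one]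
  rw [Matrix.SpecialLinearGroup.coe_mul, Matrix.SpecialLinearGroup.coe_mul, Matrix.mul_assoc]
  constructor
  · rintro rfl
    rw [← Matrix.mul_assoc, h₁, Matrix.one_mul]
  · intro h
    rw [h, ← Matrix.mul_assoc, h₂, Matrix.one_mul]

lemma trace_conj (C Y : SL2) :
    ((C⁻¹ * Y * C : SL2) : Matrix (Fin 2) (Fin 2) ℂ).trace =
      (Y : Matrix (Fin 2) (Fin 2) ℂ).trace := by
  rw [Matrix.SpecialLinearGroup.coe_mul, Matrix.trace_mul_comm,
    ← Matrix.SpecialLinearGroup.coe_mul, mul_inv_cancel_left]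

lemma conj_mul (C D Y : SL2) :
    (D * C)⁻¹ * Y * (D * C) = C⁻¹ * (D⁻¹ * Y * D) * C := by
  group

lemma case1_of_conj (D : SL2) {X Y : SL2} (h : KbCase1 (D⁻¹ * X * D) (D⁻¹ * Y * D)) :
    KbCase1 X Y := by
  have hY : Y = D * (D⁻¹ * Y * D) * D⁻¹ := by group
  rcases h with h | h <;> rw [h] at hY
  · exact Or.inl (by simpa using hY)
  · exact Or.inr (by simpa using hY)

lemma case2_of_conj (D : SL2) {X Y : SL2} (h : KbCase2 (D⁻¹ * X * D) (D⁻¹ * Y * D)) :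
    KbCase2 X Y := by
  obtain ⟨C, η, h0, h1, h2, hY, hX⟩ := h
  exact ⟨D * C, η, h0, h1, h2, by rw [conj_mul, hY], by rw [conj_mul, hX]⟩

lemma case3_of_conj (D : SL2) {X Y : SL2} (h : KbCase3 (D⁻¹ * X * D) (D⁻¹ * Y * D)) :
    KbCase3 X Y := by
  obtain ⟨C, ε, ω, δ, ω', hε, hω, hδ, hY, hX⟩ := h
  exact ⟨D * C, ε, ω, δ, ω', hε, hω, hδ, by rw [conj_mul, hY], by rw [conj_mul, hX]⟩

lemma exists_coe_eq (X : SL2) :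
    ∃ p q r s : ℂ, (X : Matrix (Fin 2) (Fin 2) ℂ) = !![p, q; r, s] ∧ p * s - q * r = 1 :=
  ⟨_, _, _, _, Matrix.eta_fin_two _, by rw [← Matrix.det_fin_two, X.det_coe]⟩

lemma exists_conj_upper_triangular (Y : SL2) :
    ∃ (C : SL2) (η ω : ℂ), η ≠ 0 ∧
      ((C⁻¹ * Y * C : SL2) : Matrix (Fin 2) (Fin 2) ℂ) = !![η, ω; 0, η⁻¹] := by
  obtain ⟨a, b, c, d, hM, hdet⟩ := exists_coe_eq Y
  by_cases hc : c = 0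
  · subst hc
    have had : a * d = 1 := by linear_combination hdet
    exact ⟨1, a, b, left_ne_zero_of_mul_eq_one had, by
      simp [hM, eq_inv_of_mul_eq_one_right had]⟩
  · obtain ⟨s, hs⟩ := IsAlgClosed.exists_pow_nat_eq ((a + d) ^ 2 - 4) two_pos
    obtain ⟨η, hη⟩ : ∃ η : ℂ, η * (a + d - η) = 1 :=
      ⟨(a + d + s) / 2, by linear_combination -hs / 4⟩
    refine ⟨⟨!![η - d, -c⁻¹; c, 0], by simp [hc]⟩, η, -c⁻¹,
      left_ne_zero_of_mul_eq_one hη, ?_⟩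
    refine (coe_conj_eq_iff _ _ _).mpr ?_
    rw [hM, ← eq_inv_of_mul_eq_one_right hη]
    ext i j
    fin_cases i <;> fin_cases j <;> simp [Matrix.mul_apply, Fin.sum_univ_two, hc]
    · linear_combination hη - hdet
    · ring
    · ring

lemma case2_of_diagonalizable {X Y : SL2} {η ω : ℂ} (hη : η ≠ 0) (hη2 : η ^ 2 ≠ 1)
    (hY : (Y : Matrix (Fin 2) (Fin 2) ℂ) = !![η, ω; 0, η⁻¹]) (hrel : Y * X * Y = X) :
    KbCase2 X Y := by
  obtain ⟨p, q, r, s, hX, hdet⟩ := exists_coe_eq X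
  have hrel' := congrArg Subtype.val hrel
  simp only [Matrix.SpecialLinearGroup.coe_mul, hY, hX] at hrel'
  have e00 := congrFun (congrFun hrel' 0) 0
  have e11 := congrFun (congrFun hrel' 1) 1
  simp [Matrix.mul_apply, Fin.sum_univ_two] at e00 e11
  field_simp at e11
  have hne : 1 - η ^ 2 ≠ 0 := sub_ne_zero.mpr hη2.symm
  obtain ⟨u, hu⟩ : ∃ u, u * (1 - η ^ 2) = ω * η := ⟨ω * η / (1 - η ^ 2), by field_simp⟩
  have hp : p = u * r := mul_right_cancel₀ hne (by linear_combination -e00 - r * hu)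
  have hs : s = -(u * r) := mul_right_cancel₀ hne (by linear_combination e11 + r * hu)
  have hdet' : r * (u * p + q) = -1 := by
    rw [hs, hp] at hdet
    rw [hp]
    linear_combination -hdet
  have hr : r ≠ 0 := left_ne_zero_of_mul (hdet'.trans_ne (by simp))
  obtain ⟨t, ht⟩ := IsAlgClosed.exists_pow_nat_eq r⁻¹ two_pos
  have ht0 : t ≠ 0 := by
    rintro rfl
    simp [eq_comm, hr] at ht
  have hrt : r * t ^ 2 = 1 := by rw [ht, mul_inv_cancel₀ hr]
  refine ⟨⟨!![t, u / t; 0, t⁻¹], by simp [ht0]⟩, η, hη, ?_, ?_, ?_, ?_⟩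
  · rintro rfl
    simp at hη2
  · rintro rfl
    simp at hη2
  · refine (coe_conj_eq_iff _ _ _).mpr ?_
    rw [hY]
    ext i j
    fin_cases i <;> fin_cases j <;> simp [Matrix.mul_apply, Fin.sum_univ_two]
    · ring
    · field_simp
      linear_combination -hu
    · ring
  · refine (coe_conj_eq_iff _ _ _).mpr ?_
    rw [hX]
    ext i j
    fin_cases i <;> fin_cases j <;> simp [Matrix.mul_apply, Fin.sum_univ_two]
    · field_simp
      rw [hp]
      linear_combination u * hrt
    · field_simp
      refine mul_left_cancel₀ hr ?_
      linear_combination hdet' + hrt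
    · field_simp
      linear_combination hrt
    · rw [hs]
      ring

lemma case1_or_case3_of_parabolic {X Y : SL2} {ε ω : ℂ} (hε : ε = 1 ∨ ε = -1)
    (hY : (Y : Matrix (Fin 2) (Fin 2) ℂ) = !![ε, ω; 0, ε]) (hrel : Y * X * Y = X) :
    KbCase1 X Y ∨ KbCase3 X Y := by
  by_cases hω : ω = 0
  · left
    subst hω
    rcases hε with rfl | rfl
    · left
      ext i j
      fin_cases i <;> fin_cases j <;> simp [hY]
    · right
      ext i j
      fin_cases i <;> fin_cases j <;> simp [hY]
  · right
    obtain ⟨p, q, r, s, hX, hdet⟩ := exists_coe_eq X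
    have hε2 : ε ^ 2 = 1 := sq_eq_one_iff.mpr hε
    have hε0 : ε ≠ 0 := by
      rintro rfl
      simp at hε2
    have hrel' := congrArg Subtype.val hrel
    simp only [Matrix.SpecialLinearGroup.coe_mul, hY, hX] at hrel'
    have e00 := congrFun (congrFun hrel' 0) 0
    have e01 := congrFun (congrFun hrel' 0) 1
    simp [Matrix.mul_apply, Fin.sum_univ_two] at e00 e01
    have hr : r = 0 := mul_left_cancel₀ (mul_ne_zero hε0 hω) (by linear_combination e00 - p * hε2)
    subst hr
    have hs : s = -p :=
      mul_left_cancel₀ (mul_ne_zero hε0 hω) (by linear_combination e01 - q * hε2)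
    subst hs
    have hp : p = Complex.I ∨ p = -Complex.I :=
      sq_eq_sq_iff_eq_or_eq_neg.mp (by rw [Complex.I_sq]; linear_combination -hdet)
    rcases hp with rfl | rfl
    · exact ⟨1, ε, ω, 1, q, hε, hω, Or.inl rfl, by simp [hY], by simp [hX]⟩
    · exact ⟨1, ε, ω, -1, q, hε, hω, Or.inr rfl, by simp [hY], by simp [hX]⟩

lemma case1_or_case2_or_case3 {X Y : SL2} (hrel : X⁻¹ * Y * X = Y⁻¹) :
    KbCase1 X Y ∨ KbCase2 X Y ∨ KbCase3 X Y := by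
  obtain ⟨D, η, ω, hη, hY⟩ := exists_conj_upper_triangular Y
  have hYXY : Y * X * Y = X := by
    have h : Y * X = X * Y⁻¹ := by rw [← hrel]; group
    rw [h, inv_mul_cancel_right]
  have hconj : (D⁻¹ * Y * D) * (D⁻¹ * X * D) * (D⁻¹ * Y * D) = D⁻¹ * X * D := by
    calc _ = D⁻¹ * (Y * X * Y) * D := by group
      _ = _ := by rw [hYXY]
  by_cases hη2 : η ^ 2 = 1
  · rw [← eq_inv_of_mul_eq_one_right ((sq η).symm.trans hη2)] at hY
    exact (case1_or_case3_of_parabolic (sq_eq_one_iff.mp hη2) hY hconj).imp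
      (case1_of_conj D) fun h => Or.inr (case3_of_conj D h)
  · exact Or.inr (Or.inl (case2_of_conj D (case2_of_diagonalizable hη hη2 hY hconj)))

lemma not_case1_and_case2 (X Y : SL2) : ¬(KbCase1 X Y ∧ KbCase2 X Y) := by
  rintro ⟨h, C, η, -, h1, h2, hY, -⟩
  have e := congrFun (congrFun hY 0) 0
  rcases h with rfl | rfl
  · exact h1 (by simpa using e.symm)
  · exact h2 (by simpa using e.symm)

lemma not_case1_and_case3 (X Y : SL2) : ¬(KbCase1 X Y ∧ KbCase3 X Y) := by
  rintro ⟨h, C, ε, ω, δ, ω', -, hω, -, hY, -⟩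
  have e := congrFun (congrFun hY 0) 1
  rcases h with rfl | rfl <;> exact hω (by simpa using e.symm)

lemma not_case2_and_case3 (X Y : SL2) : ¬(KbCase2 X Y ∧ KbCase3 X Y) := by
  rintro ⟨⟨C, η, h0, h1, h2, hY, -⟩, C', ε, ω, δ, ω', hε, -, -, hY', -⟩
  have htr := (trace_conj C Y).trans (trace_conj C' Y).symm
  rw [hY, hY', Matrix.trace_fin_two_of, Matrix.trace_fin_two_of] at htr
  field_simp at htr
  have hε2 : ε ^ 2 = 1 := by rcases hε with rfl | rfl <;> norm_num
  have hηε : η = ε := sub_eq_zero.mp (pow_eq_zero_iff two_ne_zero |>.mp (by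
    linear_combination htr + hε2))
  rcases hε with rfl | rfl
  · exact h1 hηε
  · exact h2 hηε

end KbRep

theorem klein_bottle_rep_classification (X Y : SL2)
    (hrel : X⁻¹ * Y * X = Y⁻¹) :
    (KbCase1 X Y ∨ KbCase2 X Y ∨ KbCase3 X Y) ∧
    ¬(KbCase1 X Y ∧ KbCase2 X Y) ∧
    ¬(KbCase1 X Y ∧ KbCase3 X Y) ∧
    ¬(KbCase2 X Y ∧ KbCase3 X Y) := by
  exact ⟨KbRep.case1_or_case2_or_case3 hrel, KbRep.not_case1_and_case2 X Y,
    KbRep.not_case1_and_case3 X Y, KbRep.not_case2_and_case3 X Y⟩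
end

section
/- Let X, Y be matrices in SL(2,ℂ) satisfying X⁻¹YX = Y⁻¹, and suppose tr Y ≠ 2 and tr Y ≠ −2. Then tr X = 0 and X² = −1 (the negative of the identity matrix); in particular X has order 4. -/
open Matrix Complex

theorem klein_bottle_irreducible_X_trace_free (X Y : SL2)
    (hrel : X⁻¹ * Y * X = Y⁻¹)
    (htr : Matrix.trace (Y : Matrix (Fin 2) (Fin 2) ℂ) ≠ 2)
    (htr' : Matrix.trace (Y : Matrix (Fin 2) (Fin 2) ℂ) ≠ -2) :
    Matrix.trace (X : Matrix (Fin 2) (Fin 2) ℂ) = 0 ∧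
    X ^ 2 = -1 ∧ orderOf X = 4 := by
  have hYX : Y * X = X * Y⁻¹ := by rw [← hrel]; group
  have hmat := congrArg (fun Z : SL2 => (Z : Matrix (Fin 2) (Fin 2) ℂ)) hYX
  have hX := X.det_coe
  have hY := Y.det_coe
  rw [Matrix.det_fin_two] at hX hY
  simp only [Matrix.SpecialLinearGroup.coe_mul, Matrix.SpecialLinearGroup.coe_inv,
    Matrix.adjugate_fin_two] at hmat
  have h00 := congrFun (congrFun hmat 0) 0
  have h01 := congrFun (congrFun hmat 0) 1
  have h10 := congrFun (congrFun hmat 1) 0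
  have h11 := congrFun (congrFun hmat 1) 1
  simp [Matrix.mul_apply, Fin.sum_univ_two] at h00 h01 h10 h11
  rw [Matrix.trace_fin_two] at htr htr'
  have htrX : X 0 0 + X 1 1 = 0 := by
    by_contra hne
    have hb : Y 0 1 = 0 := mul_right_cancel₀ hne (by linear_combination h01)
    have hc : Y 1 0 = 0 := mul_right_cancel₀ hne (by linear_combination h10)
    have hd : Y 0 0 = Y 1 1 := mul_right_cancel₀ hne (by linear_combination h00 - h11)
    have hsq : (Y 0 0 - 1) * (Y 0 0 + 1) = 0 := by
      linear_combination hY + Y 0 0 * hd + Y 1 0 * hb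
    rcases mul_eq_zero.mp hsq with h | h
    · exact htr (by linear_combination 2 * h - hd)
    · exact htr' (by linear_combination 2 * h - hd)
  have hXsq : X ^ 2 = -1 := by
    ext i j
    fin_cases i <;> fin_cases j <;>
      simp [pow_two, Matrix.mul_apply, Fin.sum_univ_two]
    · linear_combination X 0 0 * htrX - hX
    · linear_combination X 0 1 * htrX
    · linear_combination X 1 0 * htrX
    · linear_combination X 1 1 * htrX - hX
  refine ⟨by rw [Matrix.trace_fin_two]; exact htrX, hXsq, ?_⟩
  have hne : ¬X ^ 2 ^ 1 = 1 := by
    rw [pow_one, hXsq]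
    intro h
    have h1 := congrArg (fun Z : SL2 => Z 0 0) h
    norm_num at h1
  have hfour : X ^ 2 ^ (1 + 1) = 1 := by
    rw [show 2 ^ (1 + 1) = 2 * 2 from rfl, pow_mul, hXsq, neg_one_sq]
  exact orderOf_eq_prime_pow hne hfour
end

section
/- Let m ≥ 1 and let X̃, Ỹ be invertible m×m complex matrices satisfying Ỹ X̃ = X̃ Ỹ⁻¹. If det(Ỹ − 1) ≠ 0, then the sequence of linear maps 0 → ℂᵐ →^{∂₂} ℂᵐ ⊕ ℂᵐ →^{∂₁} ℂᵐ → 0, where ∂₂(v) = ((1 − Ỹ)v, (−X̃Ỹ − 1)v) and ∂₁(v, w) = (X̃ − 1)v + (Ỹ − 1)w, is exact: ∂₂ is injective, ∂₁ is surjective, and ker ∂₁ = im ∂₂. -/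
open Matrix

/-- The composite of the two boundary maps vanishes as soon as `Y * X * Y = X`. -/
theorem klein_bottle_boundary_comp {R : Type*} [Ring R] {X Y : R} (h : Y * X * Y = X) :
    (X - 1) * (1 - Y) + (Y - 1) * (-(X * Y) - 1) = 0 := by
  have expand : (X - 1) * (1 - Y) + (Y - 1) * (-(X * Y) - 1) = X - Y * X * Y := by
    noncomm_ring
  rw [expand, h, sub_self]

theorem klein_bottle_twisted_complex_acyclic (m : ℕ) (hm : 1 ≤ m)
    (X Y : Matrix (Fin m) (Fin m) ℂ)
    (hX : IsUnit X) (hY : IsUnit Y)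
    (hrel : Y * X = X * Y⁻¹)
    (hdet : (Y - 1).det ≠ 0) :
    Function.Injective
      (fun v : Fin m → ℂ => ((1 - Y) *ᵥ v, (-(X * Y) - 1) *ᵥ v)) ∧
    Function.Surjective
      (fun vw : (Fin m → ℂ) × (Fin m → ℂ) => (X - 1) *ᵥ vw.1 + (Y - 1) *ᵥ vw.2) ∧
    (∀ vw : (Fin m → ℂ) × (Fin m → ℂ),
      (X - 1) *ᵥ vw.1 + (Y - 1) *ᵥ vw.2 = 0 ↔
        ∃ u : Fin m → ℂ, ((1 - Y) *ᵥ u, (-(X * Y) - 1) *ᵥ u) = vw) := by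
  have hYXY : Y * X * Y = X := by
    rw [hrel, Matrix.mul_assoc, nonsing_inv_mul _ ((isUnit_iff_isUnit_det Y).1 hY),
      Matrix.mul_one]
  have hunit : IsUnit (Y - 1) := (isUnit_iff_isUnit_det _).2 hdet.isUnit
  have hunit' : IsUnit (1 - Y) := by simpa using hunit.neg
  have hcomp (u : Fin m → ℂ) :
      (X - 1) *ᵥ ((1 - Y) *ᵥ u) + (Y - 1) *ᵥ ((-(X * Y) - 1) *ᵥ u) = 0 := by
    rw [mulVec_mulVec, mulVec_mulVec, ← add_mulVec, klein_bottle_boundary_comp hYXY,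
      zero_mulVec]
  refine ⟨fun u v huv => mulVec_injective_iff_isUnit.2 hunit' (congrArg Prod.fst huv),
    fun z => ?_, fun ⟨v, w⟩ => ⟨fun hvw => ?_, ?_⟩⟩
  · obtain ⟨w, hw⟩ := mulVec_surjective_iff_isUnit.2 hunit z
    exact ⟨(0, w), by simpa using hw⟩
  · obtain ⟨u, rfl⟩ := mulVec_surjective_iff_isUnit.2 hunit' v
    exact ⟨u, Prod.ext rfl (mulVec_injective_iff_isUnit.2 hunit
      (add_left_cancel ((hcomp u).trans hvw.symm)))⟩
  · rintro ⟨u, hu⟩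
    rw [← hu]
    exact hcomp u
end

section
/- Fix an integer n with n ∉ {0, −1}. Let (A, B, X, Y) be an irreducible quadruple of matrices in SL(2,ℂ) satisfying A² = B^{2n+1}, X⁻¹YX = Y⁻¹, B⁻ⁿA = Y⁻¹, and A² = Y⁻¹X². Then A and B commute: AB = BA. -/
open Matrix Complex

/-- A quadruple of `SL(2,ℂ)` matrices is irreducible if no one-dimensional subspace
of `ℂ²` is invariant under all four matrices, i.e. there is no common eigenvector. -/
def IrredQuad (A B X Y : SL2) : Prop :=
  ¬ ∃ v : Fin 2 → ℂ, v ≠ 0 ∧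
    (∃ a : ℂ, (A : Matrix (Fin 2) (Fin 2) ℂ) *ᵥ v = a • v) ∧
    (∃ b : ℂ, (B : Matrix (Fin 2) (Fin 2) ℂ) *ᵥ v = b • v) ∧
    (∃ c : ℂ, (X : Matrix (Fin 2) (Fin 2) ℂ) *ᵥ v = c • v) ∧
    (∃ d : ℂ, (Y : Matrix (Fin 2) (Fin 2) ℂ) *ᵥ v = d • v)

/-- In `SL(2,ℂ)`, an element commuting with `A ^ 2` commutes with `A`, unless `A ^ 2 = -1`. -/
lemma SL2.commute_or_sq_eq_neg_one {A B : SL2} (h : Commute (A ^ 2) B) :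
    Commute A B ∨ A ^ 2 = -1 := by
  have hsq : (A : Matrix (Fin 2) (Fin 2) ℂ) ^ 2 = A.val.trace • A.val - 1 := by
    have hdet := A.det_coe
    rw [Matrix.det_fin_two] at hdet
    ext i j
    fin_cases i <;> fin_cases j <;>
      simp [pow_two, Matrix.mul_apply, Fin.sum_univ_two, Matrix.trace_fin_two] <;> grind
  by_cases ht : A.val.trace = 0
  · right
    ext1 i j
    simp [hsq, ht]
  · left
    have hc : A.val ^ 2 * B.val = B.val * A.val ^ 2 := by
      simpa using congrArg Subtype.val h.eq
    simp only [hsq, sub_mul, mul_sub, one_mul, mul_one, smul_mul_assoc, mul_smul_comm,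
      sub_left_inj] at hc
    exact Subtype.ext (smul_right_injective _ ht hc)

/-- An element of `SL(2,ℂ)` equal to its own inverse is central. -/
lemma SL2.commute_of_eq_inv {Y : SL2} (h : Y = Y⁻¹) (C : SL2) : Commute Y C := by
  have hval : Y.val = Y.val.adjugate := by
    simpa using congrArg Subtype.val h
  rw [Matrix.adjugate_fin_two] at hval
  have h00 := congrFun₂ hval 0 0
  have h01 := congrFun₂ hval 0 1
  have h10 := congrFun₂ hval 1 0
  simp [self_eq_neg] at h00 h01 h10
  refine Subtype.ext ?_
  ext i j
  fin_cases i <;> fin_cases j <;>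
    simp [Matrix.mul_apply, Fin.sum_univ_two, h00, h01, h10, mul_comm]

theorem torus_knot_piece_abelian (n : ℤ) (hn0 : n ≠ 0) (hn1 : n ≠ -1)
    (A B X Y : SL2)
    (h1 : A ^ 2 = B ^ (2 * n + 1))
    (h2 : X⁻¹ * Y * X = Y⁻¹)
    (h3 : B ^ (-n) * A = Y⁻¹)
    (h4 : A ^ 2 = Y⁻¹ * X ^ 2)
    (hirr : IrredQuad A B X Y) :
    A * B = B * A := by
  have hcomm : Commute (A ^ 2) B := h1 ▸ (Commute.refl B).zpow_left _
  rcases SL2.commute_or_sq_eq_neg_one hcomm with h | h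
  · exact h.eq
  · have hY : Y = -X ^ 2 := by
      rw [h, eq_inv_mul_iff_mul_eq, mul_neg_one] at h4
      rw [← h4, neg_neg]
    have hXY : Commute Y X := hY ▸ ((Commute.refl X).pow_left 2).neg_left
    have hinv : Y = Y⁻¹ := by rw [← h2, mul_assoc, hXY.eq, inv_mul_cancel_left]
    have hA : A = B ^ n * Y := by rw [hinv, ← h3, _root_.zpow_neg, mul_inv_cancel_left]
    rw [hA]
    exact (((Commute.refl B).zpow_left n).mul_left (SL2.commute_of_eq_inv hinv B)).eq
end

section
/- Fix an integer n with n ∉ {0, −1}. Let (A, B, X, Y) be an irreducible quadruple of matrices in SL(2,ℂ) satisfying A² = B^{2n+1}, X⁻¹YX = Y⁻¹, B⁻ⁿA = Y⁻¹, and A² = Y⁻¹X². Then tr Y ≠ 2 and tr Y ≠ −2; in particular the pair (X, Y) is an irreducible SL(2,ℂ)-representation of the Klein bottle group. -/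
open Matrix Complex

/-- The kernel of a nonzero `2 × 2` matrix is at most one-dimensional. -/
theorem exists_eq_smul_of_mulVec_eq_zero {N : Matrix (Fin 2) (Fin 2) ℂ} (hN : N ≠ 0)
    {v w : Fin 2 → ℂ} (hv : v ≠ 0) (hNv : N *ᵥ v = 0) (hNw : N *ᵥ w = 0) :
    ∃ c : ℂ, w = c • v := by
  by_cases hdet : v 0 * w 1 - v 1 * w 0 = 0
  · by_cases h0 : v 0 = 0
    · have hv1 : v 1 ≠ 0 := fun h => hv (by ext i; fin_cases i <;> simp [h0, h])
      refine ⟨w 1 / v 1, ?_⟩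
      ext i
      fin_cases i
      · simpa [h0, hv1] using hdet
      · simp [hv1]
    · refine ⟨w 0 / v 0, ?_⟩
      ext i
      fin_cases i
      · simp [h0]
      · simp only [Fin.mk_one, Pi.smul_apply, smul_eq_mul]
        field_simp
        linear_combination hdet
  · refine absurd ?_ hN
    ext i j
    have e1 := congrFun hNv i
    have e2 := congrFun hNw i
    simp only [mulVec, dotProduct, Fin.sum_univ_two, Pi.zero_apply] at e1 e2
    apply mul_right_cancel₀ hdet
    fin_cases j
    · simp only [Fin.zero_eta, Matrix.zero_apply]
      linear_combination w 1 * e1 - v 1 * e2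
    · simp only [Fin.mk_one, Matrix.zero_apply]
      linear_combination v 0 * e2 - w 0 * e1

/-- A matrix that anticommutes with a nonzero traceless `2 × 2` matrix has trace zero. -/
theorem trace_eq_zero_of_anticommute {N X : Matrix (Fin 2) (Fin 2) ℂ} (hN : N ≠ 0)
    (htr : N.trace = 0) (h : N * X = -(X * N)) : X.trace = 0 := by
  by_contra hX
  apply hN
  have e := fun i j => congrFun (congrFun h i) j
  have e00 := e 0 0
  have e01 := e 0 1
  have e10 := e 1 0
  have e11 := e 1 1
  simp only [mul_apply, Fin.sum_univ_two, Matrix.neg_apply, trace_fin_two] at e00 e01 e10 e11 htr hX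
  ext i j
  apply mul_left_cancel₀ hX
  fin_cases i <;> fin_cases j <;> simp only [Fin.zero_eta, Fin.mk_one, Matrix.zero_apply]
  · linear_combination (e00 - e11) / 2 + X 1 1 * htr
  · linear_combination e01 - X 0 1 * htr
  · linear_combination e10 - X 1 0 * htr
  · linear_combination (e11 - e00) / 2 + X 0 0 * htr

/-- A traceless element of `SL(2,ℂ)` squares to `-1`. -/
theorem sq_eq_neg_one_of_trace_eq_zero (X : SL2)
    (h : (X : Matrix (Fin 2) (Fin 2) ℂ).trace = 0) : X ^ 2 = -1 := by
  have hd := X.det_coe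
  rw [det_fin_two] at hd
  rw [trace_fin_two] at h
  ext i j
  fin_cases i <;> fin_cases j <;>
    simp [sq, mul_apply, Fin.sum_univ_two]
  · linear_combination X 0 0 * h - hd
  · linear_combination X 0 1 * h
  · linear_combination X 1 0 * h
  · linear_combination X 1 1 * h - hd

/-- Every complex `2 × 2` matrix has an eigenvector. -/
theorem exists_eigenvector (M : Matrix (Fin 2) (Fin 2) ℂ) :
    ∃ v : Fin 2 → ℂ, v ≠ 0 ∧ ∃ c : ℂ, M *ᵥ v = c • v := by
  obtain ⟨c, hc⟩ := Module.End.exists_eigenvalue (Matrix.toLin' M)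
  obtain ⟨v, hv⟩ := hc.exists_hasEigenvector
  exact ⟨v, hv.2, c, by simpa using hv.apply_eq_smul⟩

/-- The Cayley–Hamilton identity in `SL(2,ℂ)`. -/
theorem coe_inv_eq_trace_smul_sub (Y : SL2) :
    ((Y⁻¹ : SL2) : Matrix (Fin 2) (Fin 2) ℂ) =
      (Y : Matrix (Fin 2) (Fin 2) ℂ).trace • (1 : Matrix (Fin 2) (Fin 2) ℂ) - Y := by
  rw [Matrix.SpecialLinearGroup.coe_inv, adjugate_fin_two]
  ext i j
  fin_cases i <;> fin_cases j <;> simp [trace_fin_two]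

/-- If `Y = ±1`, the relations leave only one matrix that is not scalar. -/
theorem not_irredQuad_of_scalar {n : ℤ} {A B X Y : SL2} {ε : ℂ}
    (h1 : A ^ 2 = B ^ (2 * n + 1)) (h3 : B ^ (-n) * A = Y⁻¹)
    (hε : ε ^ 2 = 1) (hY : (Y : Matrix (Fin 2) (Fin 2) ℂ) = ε • 1) :
    ¬ IrredQuad A B X Y := by
  have hYY : Y * Y = 1 := by
    apply Subtype.ext
    simp [hY, smul_smul, ← pow_two ε, hε]
  have hA : A = B ^ n * Y := by
    rw [inv_eq_of_mul_eq_one_left hYY] at h3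
    rw [← h3, ← mul_assoc, ← _root_.zpow_add]
    simp
  have hcomm : Commute Y (B ^ n) := by
    apply Subtype.ext
    simp [hY]
  have hB : B = 1 := by
    rw [hA, hcomm.symm.mul_pow, sq Y, hYY, mul_one, sq, ← _root_.zpow_add, ← two_mul,
      _root_.zpow_add_one] at h1
    exact left_eq_mul.mp h1
  have hAY : A = Y := by simp [hA, hB]
  obtain ⟨v, hv, hc⟩ := exists_eigenvector X
  have hYv : ∃ d : ℂ, (Y : Matrix (Fin 2) (Fin 2) ℂ) *ᵥ v = d • v :=
    ⟨ε, by rw [hY, smul_mulVec, one_mulVec]⟩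
  exact not_not_intro ⟨v, hv, hAY ▸ hYv, ⟨1, by simp [hB]⟩, hc, hYv⟩

/-- If `Y` is parabolic, the relations force all four matrices to fix its eigenline. -/
theorem not_irredQuad_of_parabolic {n : ℤ} {A B X Y : SL2} {ε : ℂ}
    (h1 : A ^ 2 = B ^ (2 * n + 1)) (h2 : X⁻¹ * Y * X = Y⁻¹) (h4 : A ^ 2 = Y⁻¹ * X ^ 2)
    (hε : ε ^ 2 = 1) (htr : (Y : Matrix (Fin 2) (Fin 2) ℂ).trace = 2 * ε)
    (hY : (Y : Matrix (Fin 2) (Fin 2) ℂ) ≠ ε • 1) :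
    ¬ IrredQuad A B X Y := by
  set N : Matrix (Fin 2) (Fin 2) ℂ := Y - ε • 1 with hNdef
  have hN : N ≠ 0 := sub_ne_zero.mpr hY
  have hNtr : N.trace = 0 := by
    simp [hNdef, htr, mul_comm]
  have hNdet : N.det = 0 := by
    have hd := Y.det_coe
    rw [det_fin_two] at hd ⊢
    rw [trace_fin_two] at htr
    simp [hNdef]
    linear_combination hd - ε * htr - hε
  have hanti : N * (X : Matrix (Fin 2) (Fin 2) ℂ) = -(X * N) := by
    have h : Y * X = X * Y⁻¹ := by rw [← h2]; group
    have h' := congrArg (fun M : SL2 => (M : Matrix (Fin 2) (Fin 2) ℂ)) h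
    simp only [Matrix.SpecialLinearGroup.coe_mul, coe_inv_eq_trace_smul_sub, htr] at h'
    rw [hNdef, sub_mul, h', mul_sub, mul_sub, two_mul, add_smul, mul_add]
    simp only [smul_mul_assoc, mul_smul_comm, one_mul, mul_one]
    abel
  have hA2 : A ^ 2 = -Y⁻¹ := by
    rw [h4, sq_eq_neg_one_of_trace_eq_zero X (trace_eq_zero_of_anticommute hN hNtr hanti)]
    simp
  have hYA : Y = -(A ^ 2)⁻¹ := by
    rw [hA2, eq_comm, neg_eq_iff_eq_neg, inv_eq_iff_mul_eq_one]
    simp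
  have commY : ∀ M : SL2, Commute M (A ^ 2) → Commute M Y := fun M hM => by
    rw [hYA]
    exact hM.inv_right.neg_right
  obtain ⟨v, hv, hNv⟩ := exists_mulVec_eq_zero_iff.mpr hNdet
  have eigen_of_commute : ∀ M : SL2, Commute M Y →
      ∃ c : ℂ, (M : Matrix (Fin 2) (Fin 2) ℂ) *ᵥ v = c • v := fun M hM => by
    have h' := congrArg (fun M : SL2 => (M : Matrix (Fin 2) (Fin 2) ℂ)) hM.eq
    simp only [Matrix.SpecialLinearGroup.coe_mul] at h'
    have hMN : N * (M : Matrix (Fin 2) (Fin 2) ℂ) = M * N := by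
      simp [hNdef, sub_mul, mul_sub, h']
    refine exists_eq_smul_of_mulVec_eq_zero hN hv hNv ?_
    rw [mulVec_mulVec, hMN, ← mulVec_mulVec, hNv, mulVec_zero]
  refine not_not_intro ⟨v, hv, eigen_of_commute A (commY A (Commute.self_pow A 2)),
    eigen_of_commute B (commY B (h1 ▸ Commute.self_zpow B _)), ?_,
    eigen_of_commute Y (Commute.refl Y)⟩
  refine exists_eq_smul_of_mulVec_eq_zero hN hv hNv ?_
  rw [mulVec_mulVec, hanti, neg_mulVec, ← mulVec_mulVec, hNv, mulVec_zero, neg_zero]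

theorem klein_bottle_piece_irreducible (n : ℤ) (hn0 : n ≠ 0) (hn1 : n ≠ -1)
    (A B X Y : SL2)
    (h1 : A ^ 2 = B ^ (2 * n + 1))
    (h2 : X⁻¹ * Y * X = Y⁻¹)
    (h3 : B ^ (-n) * A = Y⁻¹)
    (h4 : A ^ 2 = Y⁻¹ * X ^ 2)
    (hirr : IrredQuad A B X Y) :
    Matrix.trace (Y : Matrix (Fin 2) (Fin 2) ℂ) ≠ 2 ∧
    Matrix.trace (Y : Matrix (Fin 2) (Fin 2) ℂ) ≠ -2 := by
  have key : ∀ ε : ℂ, ε ^ 2 = 1 → (Y : Matrix (Fin 2) (Fin 2) ℂ).trace ≠ 2 * ε := by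
    intro ε hε htr
    by_cases hY : (Y : Matrix (Fin 2) (Fin 2) ℂ) = ε • 1
    · exact not_irredQuad_of_scalar h1 h3 hε hY hirr
    · exact not_irredQuad_of_parabolic h1 h2 h4 hε htr hY hirr
  exact ⟨by simpa using key 1 (by norm_num), by simpa using key (-1) (by norm_num)⟩
end

section
/- Fix an integer n with n ∉ {0, −1} and set p = |4n+1|. Let (A, B, X, Y) be an irreducible quadruple of matrices in SL(2,ℂ) satisfying A² = B^{2n+1}, X⁻¹YX = Y⁻¹, B⁻ⁿA = Y⁻¹, and A² = Y⁻¹X². Then Bᵖ = 1, Aᵖ = −1, and (B⁻ⁿA)ᵖ = −1 while B⁻ⁿA ≠ −1. Consequently the matrix B⁻ⁿA has order 2p_k in SL(2,ℂ) for some divisor p_k of p with p_k > 1. -/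
open Matrix Complex

namespace SL2

theorem eq_one_or_eq_neg_one_of_scalar (M : SL2) (h01 : M 0 1 = 0) (h10 : M 1 0 = 0)
    (h : M 0 0 = M 1 1) : M = 1 ∨ M = -1 := by
  have hd := M.det_coe
  rw [Matrix.det_fin_two, h01, h10, h, zero_mul, sub_zero, mul_self_eq_one_iff] at hd
  refine hd.imp (fun hd => ?_) (fun hd => ?_)
  all_goals
    ext i j
    fin_cases i <;> fin_cases j <;> simp [h01, h10, h, hd]

theorem sq_eq_one {M : SL2} (h : M ^ 2 = 1) : M = 1 ∨ M = -1 := by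
  have hinv : M = M⁻¹ := eq_inv_of_mul_eq_one_left (by rwa [← sq])
  have hentry (i j : Fin 2) : M i j = (M⁻¹ : SL2) i j := by rw [← hinv]
  have h00 := hentry 0 0
  have h01 := hentry 0 1
  have h10 := hentry 1 0
  simp only [Matrix.SpecialLinearGroup.coe_inv, Matrix.adjugate_fin_two] at h00 h01 h10
  simp only [Matrix.of_apply, Matrix.cons_val', Matrix.cons_val_zero, Matrix.cons_val_one,
    Matrix.cons_val_fin_one] at h00 h01 h10
  exact eq_one_or_eq_neg_one_of_scalar M (self_eq_neg.mp h01) (self_eq_neg.mp h10) h00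

/-- The centralizer of a non-central element of `SL(2, ℂ)` is commutative. -/
theorem commute_of_commute {C M N : SL2} (hC1 : C ≠ 1) (hC2 : C ≠ -1)
    (hM : Commute C M) (hN : Commute C N) : Commute M N := by
  have hCM (i j : Fin 2) : (C * M : SL2) i j = (M * C : SL2) i j := by rw [hM.eq]
  have hCN (i j : Fin 2) : (C * N : SL2) i j = (N * C : SL2) i j := by rw [hN.eq]
  simp only [Matrix.SpecialLinearGroup.coe_mul, Matrix.mul_apply, Fin.sum_univ_two] at hCM hCN
  have m00 := hCM 0 0
  have m01 := hCM 0 1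
  have m10 := hCM 1 0
  have n00 := hCN 0 0
  have n01 := hCN 0 1
  have n10 := hCN 1 0
  have hne : C 0 1 ≠ 0 ∨ C 1 0 ≠ 0 ∨ C 0 0 - C 1 1 ≠ 0 := by
    by_contra! h
    exact (eq_one_or_eq_neg_one_of_scalar C h.1 h.2.1 (sub_eq_zero.mp h.2.2)).elim hC1 hC2
  rw [commute_iff_eq]
  ext i j
  simp only [Matrix.SpecialLinearGroup.coe_mul, Matrix.mul_apply, Fin.sum_univ_two]
  rcases hne with h | h | h <;> fin_cases i <;> fin_cases j <;>
    simp only [Fin.zero_eta, Fin.mk_one] <;> apply mul_left_cancel₀ h <;> grind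

/-- The subgroup of `SL(2, ℂ)` preserving the line spanned by `v`. -/
def lineStabilizer (v : Fin 2 → ℂ) (hv : v ≠ 0) : Subgroup SL2 where
  carrier := {M | ∃ c : ℂ, (M : Matrix (Fin 2) (Fin 2) ℂ) *ᵥ v = c • v}
  one_mem' := ⟨1, by simp⟩
  mul_mem' := by
    rintro M N ⟨c, hc⟩ ⟨d, hd⟩
    refine ⟨d * c, ?_⟩
    rw [Matrix.SpecialLinearGroup.coe_mul, ← Matrix.mulVec_mulVec, hd, Matrix.mulVec_smul, hc,
      smul_smul]
  inv_mem' := by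
    rintro M ⟨c, hc⟩
    have hinv : ((M⁻¹ : SL2) : Matrix (Fin 2) (Fin 2) ℂ) *ᵥ (c • v) = v := by
      rw [← hc, Matrix.mulVec_mulVec, ← Matrix.SpecialLinearGroup.coe_mul]
      simp
    have hc0 : c ≠ 0 := by
      rintro rfl
      exact hv (by simpa using hinv.symm)
    refine ⟨c⁻¹, ?_⟩
    rw [Matrix.mulVec_smul] at hinv
    rw [eq_inv_smul_iff₀ hc0, hinv]

theorem neg_one_mem_lineStabilizer (v : Fin 2 → ℂ) (hv : v ≠ 0) : -1 ∈ lineStabilizer v hv :=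
  ⟨-1, by simp [Matrix.neg_mulVec]⟩

theorem exists_mem_lineStabilizer (M : SL2) : ∃ v, ∃ hv : v ≠ 0, M ∈ lineStabilizer v hv := by
  obtain ⟨c, hc⟩ := Module.End.exists_eigenvalue (Matrix.toLin' (M : Matrix (Fin 2) (Fin 2) ℂ))
  obtain ⟨v, hv⟩ := hc.exists_hasEigenvector
  exact ⟨v, hv.2, c, by simpa using hv.apply_eq_smul⟩

end SL2

theorem IrredQuad.not_mem_lineStabilizer {A B X Y : SL2} (h : IrredQuad A B X Y)
    {v : Fin 2 → ℂ} {hv : v ≠ 0} (hA : A ∈ SL2.lineStabilizer v hv)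
    (hB : B ∈ SL2.lineStabilizer v hv) (hX : X ∈ SL2.lineStabilizer v hv) :
    Y ∉ SL2.lineStabilizer v hv :=
  fun hY => h ⟨v, hv, hA, hB, hX, hY⟩

/-- The matrices `A` and `B` of an irreducible quadruple are powers of `Y`. -/
theorem IrredQuad.eq_zpow {n : ℤ} {A B X Y : SL2}
    (h1 : A ^ 2 = B ^ (2 * n + 1)) (h2 : X⁻¹ * Y * X = Y⁻¹)
    (h3 : B ^ (-n) * A = Y⁻¹) (h4 : A ^ 2 = Y⁻¹ * X ^ 2) (hirr : IrredQuad A B X Y) :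
    B = Y ^ (-2 : ℤ) ∧ A = Y ^ (-(2 * n + 1)) := by
  have hA : A = B ^ n * Y⁻¹ := by rw [← h3, _root_.zpow_neg, mul_inv_cancel_left]
  have hconj : X⁻¹ * A ^ 2 * X = Y ^ 2 * A ^ 2 := by
    have : X⁻¹ * Y⁻¹ * X = Y := by
      have := congrArg (·⁻¹) h2
      simpa [mul_assoc] using this
    calc X⁻¹ * A ^ 2 * X = (X⁻¹ * Y⁻¹ * X) * X ^ 2 := by rw [h4]; group
      _ = Y ^ 2 * A ^ 2 := by rw [this, h4]; group
  have hAB : Commute A B := by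
    by_cases hcentral : A ^ 2 = 1 ∨ A ^ 2 = -1
    · exfalso
      have hY2 : Y ^ 2 = 1 := by
        rcases hcentral with h | h <;> rw [h] at hconj <;> simpa using hconj.symm
      have hBone : B = 1 := by
        have hYc : Y = 1 ∨ Y = -1 := SL2.sq_eq_one hY2
        have hA2 : A ^ 2 = B ^ (2 * n) := by
          rw [hA, mul_comm 2 n, _root_.zpow_mul]
          rcases hYc with rfl | rfl <;> simp [zpow_ofNat]
        rw [hA2, _root_.zpow_add_one] at h1
        simpa using h1.symm
      obtain ⟨v, hv, hX⟩ := SL2.exists_mem_lineStabilizer X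
      have hY : Y ∈ SL2.lineStabilizer v hv := by
        rcases SL2.sq_eq_one hY2 with h | h <;> rw [h]
        exacts [one_mem _, SL2.neg_one_mem_lineStabilizer v hv]
      refine hirr.not_mem_lineStabilizer (hv := hv) ?_ ?_ hX hY
      · rw [hA, hBone, _root_.one_zpow, one_mul]
        exact inv_mem hY
      · rw [hBone]
        exact one_mem _
    · push Not at hcentral
      refine SL2.commute_of_commute hcentral.1 hcentral.2 (Commute.pow_self A 2) ?_
      rw [h1]
      exact Commute.zpow_self B _
  have hBY : Commute B Y⁻¹ := by
    rw [← h3]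
    exact (Commute.self_zpow B _).mul_right hAB.symm
  have hB : B = Y ^ (-2 : ℤ) := by
    have hA2 : A ^ 2 = B ^ (2 * n) * Y ^ (-2 : ℤ) := by
      rw [hA, (hBY.zpow_left n).mul_pow, mul_comm 2 n, _root_.zpow_mul]
      simp [zpow_ofNat, _root_.zpow_neg]
    rw [hA2, _root_.zpow_add_one] at h1
    exact (mul_left_cancel h1).symm
  refine ⟨hB, ?_⟩
  rw [hA, hB, ← _root_.zpow_mul, ← _root_.zpow_neg_one, ← _root_.zpow_add]
  congr 1
  ring

theorem meridian_image_order (n : ℤ) (hn0 : n ≠ 0) (hn1 : n ≠ -1)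
    (p : ℕ) (hp : p = (4 * n + 1).natAbs)
    (A B X Y : SL2)
    (h1 : A ^ 2 = B ^ (2 * n + 1))
    (h2 : X⁻¹ * Y * X = Y⁻¹)
    (h3 : B ^ (-n) * A = Y⁻¹)
    (h4 : A ^ 2 = Y⁻¹ * X ^ 2)
    (hirr : IrredQuad A B X Y) :
    B ^ p = 1 ∧ A ^ p = -1 ∧ (B ^ (-n) * A) ^ p = -1 ∧ B ^ (-n) * A ≠ -1 ∧
    ∃ pk : ℕ, pk ∣ p ∧ 1 < pk ∧ orderOf (B ^ (-n) * A) = 2 * pk := by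
  obtain ⟨hB, hA⟩ := hirr.eq_zpow h1 h2 h3 h4
  have hneg : (1 : SL2) ≠ -1 := by
    intro h
    have h00 := congrArg (fun M : SL2 => M 0 0) h
    norm_num at h00
  have hX2 : X ^ 2 = (Y ^ (4 * n + 1))⁻¹ := by
    have : X ^ 2 = Y * A ^ 2 := by rw [h4, mul_inv_cancel_left]
    rw [this, hA, ← zpow_natCast, ← _root_.zpow_mul, ← _root_.zpow_one_add, ← _root_.zpow_neg]
    congr 1
    push_cast
    ring
  have hYpow : Y ^ (4 * n + 1) = -1 := by
    have hconj : X⁻¹ * Y ^ (4 * n + 1) * X = (Y ^ (4 * n + 1))⁻¹ := by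
      have := conj_zpow (a := X⁻¹) (b := Y) (i := 4 * n + 1)
      rw [inv_inv, h2, _root_.inv_zpow] at this
      exact this.symm
    have hself : X⁻¹ * Y ^ (4 * n + 1) * X = Y ^ (4 * n + 1) := by
      rw [← inv_inv (Y ^ (4 * n + 1)), ← hX2]
      group
    have hsq : (Y ^ (4 * n + 1)) ^ 2 = 1 := by
      rw [sq]
      nth_rewrite 1 [← hself]
      rw [hconj, inv_mul_cancel]
    refine (SL2.sq_eq_one hsq).resolve_left fun hone => ?_
    obtain ⟨v, hv, hY⟩ := SL2.exists_mem_lineStabilizer Y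
    refine hirr.not_mem_lineStabilizer (hv := hv) (hA ▸ zpow_mem hY _) (hB ▸ zpow_mem hY _) ?_ hY
    rw [hone, inv_one] at hX2
    rcases SL2.sq_eq_one hX2 with h | h <;> rw [h]
    exacts [one_mem _, SL2.neg_one_mem_lineStabilizer v hv]
  have hYp : Y ^ p = -1 := by
    rcases Int.natAbs_eq (4 * n + 1) with h | h <;> rw [← hp] at h <;> rw [h] at hYpow
    · rwa [zpow_natCast] at hYpow
    · rw [_root_.zpow_neg, zpow_natCast, inv_eq_iff_eq_inv] at hYpow
      simpa using hYpow
  have hYinv : (Y⁻¹) ^ p = -1 := by simp [inv_pow, hYp]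
  have hYne : Y⁻¹ ≠ -1 := by
    intro h
    have hY1 : Y = -1 := by simpa using inv_eq_iff_eq_inv.mp h
    obtain ⟨v, hv, hX⟩ := SL2.exists_mem_lineStabilizer X
    have hY : Y ∈ SL2.lineStabilizer v hv := hY1 ▸ SL2.neg_one_mem_lineStabilizer v hv
    exact hirr.not_mem_lineStabilizer (hA ▸ zpow_mem hY _) (hB ▸ zpow_mem hY _) hX hY
  have hpow (k : ℤ) : (Y ^ k) ^ p = (-1) ^ k := by
    rw [← zpow_natCast, zpow_comm, zpow_natCast, hYp]
  rw [h3]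
  refine ⟨?_, ?_, hYinv, hYne, ?_⟩
  · rw [hB, hpow]
    exact Even.neg_one_zpow (by decide)
  · rw [hA, hpow]
    exact Odd.neg_one_zpow ⟨-n - 1, by ring⟩
  · have hdvd : orderOf Y⁻¹ ∣ 2 * p := by
      rw [orderOf_dvd_iff_pow_eq_one, mul_comm, pow_mul, hYinv]
      simp
    have hndvd : ¬ orderOf Y⁻¹ ∣ p := by
      rw [orderOf_dvd_iff_pow_eq_one, hYinv]
      exact hneg.symm
    have heven : 2 ∣ orderOf Y⁻¹ := by
      by_contra hodd
      exact hndvd (((Nat.prime_two.coprime_iff_not_dvd.mpr hodd).symm).dvd_of_dvd_mul_left hdvd)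
    obtain ⟨k, hk⟩ := heven
    rw [hk] at hdvd
    refine ⟨k, Nat.dvd_of_mul_dvd_mul_left two_pos hdvd, ?_, hk⟩
    by_contra! hle
    have hY2 : (Y⁻¹) ^ 2 = 1 := by
      have hpos : 0 < p := by omega
      have : k ≠ 0 := by
        rintro rfl
        simp at hdvd
        omega
      obtain rfl : k = 1 := by omega
      rw [← pow_orderOf_eq_one Y⁻¹, hk]
    rcases SL2.sq_eq_one hY2 with h | h
    · rw [h, one_pow] at hYinv
      exact hneg hYinv
    · exact hYne h
end

section
/- Fix a nonzero integer n and an integer k with 1 ≤ k ≤ (|4n+1|−1)/2, and let ρ_k be the SL(2,ℂ)-representation of the twist knot group G_n = ⟨α, β | ωⁿα = βωⁿ⟩ defined by ρ_k(α) = [[i, −i],[0, −i]] and ρ_k(β) = [[i, 0],[−u_k i, −i]] with u_k = −4 sin²(kπ/(4n+1)). Then ρ_k is irreducible (the matrices ρ_k(α) and ρ_k(β) have no common eigenvector) and metabelian (the image under ρ_k of the commutator subgroup of G_n is an abelian subgroup of SL(2,ℂ)). -/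
open Matrix Complex Subgroup

/-- `u_k = -4 sin²(kπ/(4n+1))`. -/
noncomputable def uk (n : ℤ) (k : ℕ) : ℂ :=
  ((-4 * Real.sin ((k : ℝ) * Real.pi / (4 * (n : ℝ) + 1)) ^ 2 : ℝ) : ℂ)

/-- If `p` normalizes `N` and `p * q ∈ N`, then `⟨p, q⟩` is contained in `N ⟨p⟩`. -/
theorem exists_mem_mul_zpow_of_mem_closure_pair {G : Type*} [Group G] {N : Subgroup G} {p q : G}
    (hp : p ∈ normalizer (N : Set G)) (hpq : p * q ∈ N) {g : G} (hg : g ∈ closure {p, q}) :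
    ∃ c ∈ N, ∃ e : ℤ, g = c * p ^ e := by
  have conj_mem : ∀ (e : ℤ) {c : G}, c ∈ N → p ^ e * c * (p ^ e)⁻¹ ∈ N := fun e c hc =>
    (mem_normalizer_iff.mp (zpow_mem hp e) c).mp hc
  induction hg using closure_induction with
  | mem x hx =>
    rcases hx with rfl | rfl
    · exact ⟨1, N.one_mem, 1, by simp⟩
    · exact ⟨_, conj_mem (-1) hpq, -1, by group⟩
  | one => exact ⟨1, N.one_mem, 0, by simp⟩
  | mul x y _ _ hx hy =>
    obtain ⟨c, hc, e, rfl⟩ := hx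
    obtain ⟨d, hd, f, rfl⟩ := hy
    exact ⟨_, N.mul_mem hc (conj_mem e hd), e + f, by group⟩
  | inv x _ hx =>
    obtain ⟨c, hc, e, rfl⟩ := hx
    exact ⟨_, conj_mem (-e) (N.inv_mem hc), -e, by group⟩

/-- If `p` normalizes `N` and `p * q ∈ N`, then the commutator subgroup of `⟨p, q⟩`
is contained in `N`. -/
theorem commutator_closure_pair_le {G : Type*} [Group G] {N : Subgroup G} {p q : G}
    (hp : p ∈ normalizer (N : Set G)) (hpq : p * q ∈ N) :
    ⁅closure {p, q}, closure {p, q}⁆ ≤ N := by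
  rw [commutator_le]
  intro g hg h hh
  obtain ⟨c, hc, e, rfl⟩ := exists_mem_mul_zpow_of_mem_closure_pair hp hpq hg
  obtain ⟨d, hd, f, rfl⟩ := exists_mem_mul_zpow_of_mem_closure_pair hp hpq hh
  have conj_mem : ∀ (e : ℤ) {c : G}, c ∈ N → p ^ e * c * (p ^ e)⁻¹ ∈ N := fun e c hc =>
    (mem_normalizer_iff.mp (zpow_mem hp e) c).mp hc
  have key := N.mul_mem (N.mul_mem (N.mul_mem hc (conj_mem e hd))
    (conj_mem f (N.inv_mem hc))) (N.inv_mem hd)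
  convert key using 1
  rw [commutatorElement_def]
  group

/-- If `p² = q²` and `p⁴ = 1`, then `⟨p, q⟩` is metabelian. -/
theorem commute_of_mem_commutator_closure_pair {G : Type*} [Group G] {p q : G}
    (hpq : p * p = q * q) (hp : p * p * (p * p) = 1) {g h : G}
    (hg : g ∈ ⁅closure {p, q}, closure {p, q}⁆) (hh : h ∈ ⁅closure {p, q}, closure {p, q}⁆) :
    g * h = h * g := by
  have hconj : p * (p * q) * p⁻¹ = (p * q)⁻¹ := by
    rw [eq_inv_iff_mul_eq_one]
    calc p * (p * q) * p⁻¹ * (p * q) = p * p * (q * q) := by group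
      _ = 1 := by rw [← hpq, hp]
  have hnorm : p ∈ normalizer (zpowers (p * q) : Set G) := by
    have hz : ∀ m : ℤ, p * (p * q) ^ m * p⁻¹ = (p * q) ^ (-m) := fun m => by
      rw [← conj_zpow, hconj, _root_.inv_zpow']
    rw [mem_normalizer_iff]
    intro x
    constructor
    · rintro ⟨m, rfl⟩
      exact ⟨-m, (hz m).symm⟩
    · rintro ⟨m, hm⟩
      refine ⟨-m, ?_⟩
      have h := hz (-m)
      rw [neg_neg] at h
      have h' := h.trans hm
      exact mul_left_cancel (mul_right_cancel h')
  have hle := commutator_closure_pair_le hnorm (mem_zpowers (p * q))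
  obtain ⟨a, rfl⟩ := hle hg
  obtain ⟨b, rfl⟩ := hle hh
  exact zpow_mul_comm (p * q) a b

/-- The angle `kπ/m` satisfies `0 < sin² < 1` for `0 < k < |m|/2`. -/
theorem sin_sq_mul_pi_div_mem_Ioo {k : ℕ} {m : ℤ} (hk : 1 ≤ k) (hkm : 2 * k < m.natAbs) :
    Real.sin (k * Real.pi / m) ^ 2 ∈ Set.Ioo (0 : ℝ) 1 := by
  have hk0 : (0 : ℝ) < k := by exact_mod_cast hk
  have hlt : (2 * k : ℝ) < |(m : ℝ)| := by
    rw [← Int.cast_abs, Int.abs_eq_natAbs]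
    exact_mod_cast hkm
  have habs : Real.sin (k * Real.pi / m) ^ 2 = Real.sin (k * Real.pi / |(m : ℝ)|) ^ 2 := by
    rcases abs_choice (m : ℝ) with h | h <;> rw [h]
    rw [div_neg, Real.sin_neg, neg_sq]
  have hm : 0 < |(m : ℝ)| := by linarith
  have hpi := Real.pi_pos
  have hpos : 0 < k * Real.pi / |(m : ℝ)| := by positivity
  have hhalf : k * Real.pi / |(m : ℝ)| < Real.pi / 2 := by
    rw [div_lt_div_iff₀ hm two_pos]
    nlinarith
  have hsin := Real.sin_pos_of_pos_of_lt_pi hpos (by linarith)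
  have hcos := Real.cos_pos_of_mem_Ioo ⟨by linarith, hhalf⟩
  rw [habs]
  refine ⟨by positivity, ?_⟩
  nlinarith [Real.sin_sq_add_cos_sq (k * Real.pi / |(m : ℝ)|)]

/-- The matrices `[[i, -i], [0, -i]]` and `[[i, 0], [-u i, -i]]` have no common eigenvector
unless `u = 0` or `u = -4`. -/
theorem not_exists_common_eigenvector {u : ℂ} (h0 : u ≠ 0) (h4 : u ≠ -4) :
    ¬ ∃ v : Fin 2 → ℂ, v ≠ 0 ∧
      (∃ a : ℂ, !![Complex.I, -Complex.I; 0, -Complex.I] *ᵥ v = a • v) ∧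
      (∃ b : ℂ, !![Complex.I, 0; -u * Complex.I, -Complex.I] *ᵥ v = b • v) := by
  rintro ⟨v, hv, ⟨a, ha⟩, b, hb⟩
  have ha0 := congrFun ha 0
  have ha1 := congrFun ha 1
  have hb0 := congrFun hb 0
  have hb1 := congrFun hb 1
  simp [Matrix.mulVec, dotProduct, Fin.sum_univ_two] at ha0 ha1 hb0 hb1
  have hI := Complex.I_ne_zero
  by_cases hy : v 1 = 0
  · have hx : v 0 ≠ 0 := fun hx => hv (by ext i; fin_cases i <;> simp [hx, hy])
    simp [hy, h0, hx] at hb1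
  · have ha' : a = -Complex.I := by
      apply mul_right_cancel₀ hy
      linear_combination -ha1
    subst ha'
    have hxy : v 1 = 2 * v 0 := by
      apply mul_left_cancel₀ hI
      linear_combination -ha0
    have hx : v 0 ≠ 0 := fun hx => hy (by simp [hxy, hx])
    obtain rfl : Complex.I = b := hb0.resolve_right hx
    rw [hxy] at hb1
    apply h4
    apply mul_right_cancel₀ (mul_ne_zero hI hx)
    linear_combination -hb1

theorem rho_k_irreducible_metabelian (n : ℤ) (hn : n ≠ 0)
    (k : ℕ) (hk1 : 1 ≤ k) (hk2 : k ≤ ((4 * n + 1).natAbs - 1) / 2)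
    (P Q : SL2)
    (hP : (P : Matrix (Fin 2) (Fin 2) ℂ) = !![Complex.I, -Complex.I; 0, -Complex.I])
    (hQ : (Q : Matrix (Fin 2) (Fin 2) ℂ) =
      !![Complex.I, 0; -(uk n k) * Complex.I, -Complex.I]) :
    -- irreducible: `P` and `Q` have no common eigenvector
    (¬ ∃ v : Fin 2 → ℂ, v ≠ 0 ∧
      (∃ a : ℂ, (P : Matrix (Fin 2) (Fin 2) ℂ) *ᵥ v = a • v) ∧
      (∃ b : ℂ, (Q : Matrix (Fin 2) (Fin 2) ℂ) *ᵥ v = b • v)) ∧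
    -- metabelian: the image of the commutator subgroup, which is the commutator
    -- subgroup of the image `closure {P, Q}`, is abelian
    (∀ g ∈ ⁅Subgroup.closure {P, Q}, Subgroup.closure {P, Q}⁆,
     ∀ h ∈ ⁅Subgroup.closure {P, Q}, Subgroup.closure {P, Q}⁆,
      g * h = h * g) := by
  constructor
  · obtain ⟨hpos, hlt⟩ := sin_sq_mul_pi_div_mem_Ioo (m := 4 * n + 1) hk1 (by omega)
    push_cast at hpos hlt
    rw [hP, hQ]
    apply not_exists_common_eigenvector
    · rw [uk, Complex.ofReal_ne_zero]
      linarith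
    · rw [uk]
      intro h
      have h' : -4 * Real.sin ((k : ℝ) * Real.pi / (4 * (n : ℝ) + 1)) ^ 2 = -4 := by
        exact_mod_cast h
      linarith
  · have hPP : P * P = -1 := by
      ext i j
      fin_cases i <;> fin_cases j <;> simp [hP, Matrix.mul_apply, Fin.sum_univ_two]
    have hQQ : Q * Q = -1 := by
      ext i j
      fin_cases i <;> fin_cases j <;> simp [hQ, Matrix.mul_apply, Fin.sum_univ_two]
      ring
    intro g hg h hh
    exact commute_of_mem_commutator_closure_pair (hPP.trans hQQ.symm) (by simp [hPP]) hg hh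
end

section
/- Fix an integer n with n ∉ {0, −1} and set p = |4n+1|. The set of complex numbers ξ that occur as an eigenvalue of the matrix B⁻ⁿA for some irreducible quadruple (A, B, X, Y) in SL(2,ℂ) satisfying A² = B^{2n+1}, X⁻¹YX = Y⁻¹, B⁻ⁿA = Y⁻¹, A² = Y⁻¹X² is exactly {e^{±iθ} : θ = π(2j−1)/p, j = 1, …, (p−1)/2}. -/
open Matrix Complex

namespace SL2

lemma coe_mul_mulVec {M N : SL2} {v w u : Fin 2 → ℂ}
    (hN : (N : Matrix (Fin 2) (Fin 2) ℂ) *ᵥ v = w)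
    (hM : (M : Matrix (Fin 2) (Fin 2) ℂ) *ᵥ w = u) :
    ((M * N : SL2) : Matrix (Fin 2) (Fin 2) ℂ) *ᵥ v = u := by
  rw [Matrix.SpecialLinearGroup.coe_mul, ← mulVec_mulVec, hN, hM]

lemma inv_mulVec_of_mulVec {M : SL2} {v w : Fin 2 → ℂ}
    (h : (M : Matrix (Fin 2) (Fin 2) ℂ) *ᵥ v = w) :
    ((M⁻¹ : SL2) : Matrix (Fin 2) (Fin 2) ℂ) *ᵥ w = v := by
  rw [← h, mulVec_mulVec, ← Matrix.SpecialLinearGroup.coe_mul, inv_mul_cancel,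
    Matrix.SpecialLinearGroup.coe_one, one_mulVec]

lemma eigenvalue_ne_zero {M : SL2} {v : Fin 2 → ℂ} {ξ : ℂ} (hv : v ≠ 0)
    (h : (M : Matrix (Fin 2) (Fin 2) ℂ) *ᵥ v = ξ • v) : ξ ≠ 0 := by
  rintro rfl
  rw [zero_smul] at h
  have := inv_mulVec_of_mulVec h
  rw [mulVec_zero] at this
  exact hv this.symm

lemma inv_mulVec_eigenvector {M : SL2} {v : Fin 2 → ℂ} {ξ : ℂ} (hξ : ξ ≠ 0)
    (h : (M : Matrix (Fin 2) (Fin 2) ℂ) *ᵥ v = ξ • v) :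
    ((M⁻¹ : SL2) : Matrix (Fin 2) (Fin 2) ℂ) *ᵥ v = ξ⁻¹ • v := by
  have := inv_mulVec_of_mulVec h
  rw [mulVec_smul] at this
  rw [eq_inv_smul_iff₀ hξ, this]

lemma pow_mulVec_eigenvector {M : SL2} {v : Fin 2 → ℂ} {ξ : ℂ}
    (h : (M : Matrix (Fin 2) (Fin 2) ℂ) *ᵥ v = ξ • v) (k : ℕ) :
    ((M ^ k : SL2) : Matrix (Fin 2) (Fin 2) ℂ) *ᵥ v = ξ ^ k • v := by
  induction k with
  | zero => simp
  | succ k ih =>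
    rw [pow_succ]
    refine coe_mul_mulVec h ?_
    rw [mulVec_smul, ih, smul_smul, pow_succ']

lemma zpow_mulVec_eigenvector {M : SL2} {v : Fin 2 → ℂ} {ξ : ℂ} (hξ : ξ ≠ 0)
    (h : (M : Matrix (Fin 2) (Fin 2) ℂ) *ᵥ v = ξ • v) (k : ℤ) :
    ((M ^ k : SL2) : Matrix (Fin 2) (Fin 2) ℂ) *ᵥ v = ξ ^ k • v := by
  cases k with
  | ofNat k => simpa using pow_mulVec_eigenvector h k
  | negSucc k =>
    rw [zpow_negSucc, zpow_negSucc]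
    exact inv_mulVec_eigenvector (pow_ne_zero _ hξ) (pow_mulVec_eigenvector h _)

lemma commute_iff_entries (P Q : SL2) :
    Commute P Q ↔ P 0 1 * Q 1 0 = Q 0 1 * P 1 0 ∧
      (P 0 0 - P 1 1) * Q 0 1 = (Q 0 0 - Q 1 1) * P 0 1 ∧
      (P 0 0 - P 1 1) * Q 1 0 = (Q 0 0 - Q 1 1) * P 1 0 := by
  rw [commute_iff_eq, Matrix.SpecialLinearGroup.ext_iff]
  simp only [Matrix.SpecialLinearGroup.coe_mul, Matrix.mul_apply, Fin.forall_fin_two, Fin.sum_univ_two]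
  constructor
  · rintro ⟨⟨h₁, h₂⟩, h₃, h₄⟩
    refine ⟨?_, ?_, ?_⟩ <;> grind
  · rintro ⟨h₁, h₂, h₃⟩
    refine ⟨⟨?_, ?_⟩, ?_, ?_⟩ <;> grind

/-- The centralizer of a non-central element of `SL(2,ℂ)` is abelian. -/
lemma commute_or_central {P Q H : SL2} (hP : Commute P H) (hQ : Commute Q H) :
    Commute P Q ∨ ∀ R : SL2, Commute R H := by
  rw [commute_iff_entries] at hP hQ
  obtain ⟨p₁, p₂, p₃⟩ := hP
  obtain ⟨q₁, q₂, q₃⟩ := hQ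
  simp only [commute_iff_entries]
  by_cases h₁ : H 0 1 = 0
  · by_cases h₂ : H 1 0 = 0
    · by_cases h₃ : H 0 0 - H 1 1 = 0
      · right
        intro R
        simp [h₁, h₂, h₃]
      · left
        have e₁ : P 0 1 = 0 := by grind
        have e₂ : P 1 0 = 0 := by grind
        have e₃ : Q 0 1 = 0 := by grind
        have e₄ : Q 1 0 = 0 := by grind
        simp [e₁, e₂, e₃, e₄]
    · left
      refine ⟨?_, ?_, ?_⟩ <;> apply mul_left_cancel₀ h₂ <;> grind
  · left
    refine ⟨?_, ?_, ?_⟩ <;> apply mul_left_cancel₀ h₁ <;> grind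

lemma commute_of_sq_eq_one {M : SL2} (hM : M ^ 2 = 1) (R : SL2) : Commute R M := by
  rw [commute_iff_entries]
  have hd := M.det_coe
  rw [Matrix.det_fin_two] at hd
  rw [pow_two, Matrix.SpecialLinearGroup.ext_iff] at hM
  simp only [Matrix.SpecialLinearGroup.coe_mul, Matrix.mul_apply, Fin.forall_fin_two, Fin.sum_univ_two,
    Matrix.SpecialLinearGroup.coe_one, Matrix.one_apply_eq, Matrix.one_apply_ne zero_ne_one,
    Matrix.one_apply_ne one_ne_zero] at hM
  obtain ⟨⟨h₁, h₂⟩, h₃, h₄⟩ := hM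
  have ht : M 0 0 + M 1 1 ≠ 0 := by
    intro ht
    have h : M 0 0 * (M 0 0 + M 1 1) = 2 := by linear_combination h₁ + hd
    rw [ht, mul_zero] at h
    exact two_ne_zero h.symm
  have e₁ : M 0 1 = 0 := mul_left_cancel₀ ht (by linear_combination h₂)
  have e₂ : M 1 0 = 0 := mul_left_cancel₀ ht (by linear_combination h₃)
  have e₃ : M 0 0 - M 1 1 = 0 := mul_left_cancel₀ ht (by linear_combination h₁ - h₄)
  simp [e₁, e₂, e₃]

/-- In a representation of `π₁(M)` the torus-knot piece has abelian image. -/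
lemma commute_of_relations {n : ℤ} {A B X Y : SL2} (hAB : A ^ 2 = B ^ (2 * n + 1))
    (hXY : X⁻¹ * Y * X = Y⁻¹) (hM : B ^ (-n) * A = Y⁻¹) (hH : A ^ 2 = Y⁻¹ * X ^ 2) :
    Commute A B := by
  have hB : Commute B (A ^ 2) := by
    rw [hAB]
    exact (Commute.refl B).zpow_right _
  rcases commute_or_central ((Commute.refl A).pow_right 2) hB with h | h
  · exact h
  · have hY : Y⁻¹ = A ^ 2 * (X ^ 2)⁻¹ := by rw [hH]; group
    have hXc : Commute X Y⁻¹ := by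
      rw [hY]
      exact (h X).mul_right (((Commute.refl X).pow_right 2).inv_right)
    have hsq : Y⁻¹ ^ 2 = 1 := by
      have hc : Commute X Y := by simpa using hXc.inv_right
      have : X⁻¹ * Y * X = Y := by rw [mul_assoc, ← hc.eq, inv_mul_cancel_left]
      rw [pow_two]
      nth_rewrite 1 [← hXY]
      rw [this, mul_inv_cancel]
    have hA : A = B ^ n * Y⁻¹ := by rw [← hM]; group
    rw [hA]
    exact ((Commute.refl B).zpow_left n).mul_left (commute_of_sq_eq_one hsq B).symm

lemma sq_mulVec (X : SL2) (v : Fin 2 → ℂ) :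
    ((X ^ 2 : SL2) : Matrix (Fin 2) (Fin 2) ℂ) *ᵥ v =
      (X : Matrix (Fin 2) (Fin 2) ℂ).trace • ((X : Matrix (Fin 2) (Fin 2) ℂ) *ᵥ v) - v := by
  have hd := X.det_coe
  rw [Matrix.det_fin_two] at hd
  ext i
  fin_cases i <;>
    simp [pow_two, Matrix.mulVec, dotProduct, Matrix.mul_apply, Fin.sum_univ_two, Matrix.trace]
  · linear_combination (- v 0) * hd
  · linear_combination (- v 1) * hd

/-- The eigenvalues of the meridian in an irreducible representation in which
the torus-knot piece is sent to the powers of the meridian. -/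
lemma eigenvalue_of_dihedral {M X : SL2} {m : ℤ} (hMX : X⁻¹ * M * X = M⁻¹) (hX : X ^ 2 = M ^ m)
    (hirr : ¬ ∃ v : Fin 2 → ℂ, v ≠ 0 ∧
      (∃ c : ℂ, c ≠ 0 ∧ (M : Matrix (Fin 2) (Fin 2) ℂ) *ᵥ v = c • v) ∧
      (∃ c : ℂ, (X : Matrix (Fin 2) (Fin 2) ℂ) *ᵥ v = c • v))
    {v : Fin 2 → ℂ} {ξ : ℂ} (hv : v ≠ 0)
    (h : (M : Matrix (Fin 2) (Fin 2) ℂ) *ᵥ v = ξ • v) : ξ ^ m = -1 ∧ ξ ≠ -1 := by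
  have hξ := eigenvalue_ne_zero hv h
  have hXv : ∀ c : ℂ, (X : Matrix (Fin 2) (Fin 2) ℂ) *ᵥ v ≠ c • v :=
    fun c hc => hirr ⟨v, hv, ⟨ξ, hξ, h⟩, c, hc⟩
  have hsq := sq_mulVec X v
  rw [hX, zpow_mulVec_eigenvector hξ h m] at hsq
  have ht : (X : Matrix (Fin 2) (Fin 2) ℂ).trace = 0 := by
    by_contra ht
    apply hXv ((X : Matrix (Fin 2) (Fin 2) ℂ).trace⁻¹ * (ξ ^ m + 1))
    rw [mul_smul, eq_inv_smul_iff₀ ht, add_smul, hsq]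
    simp
  have hm : ξ ^ m = -1 := by
    rw [ht, zero_smul, zero_sub, ← neg_one_smul ℂ v] at hsq
    exact smul_left_injective ℂ hv hsq
  refine ⟨hm, ?_⟩
  rintro rfl
  set w := (X : Matrix (Fin 2) (Fin 2) ℂ) *ᵥ v with hw
  have hXw : (X : Matrix (Fin 2) (Fin 2) ℂ) *ᵥ w = -v := by
    have := sq_mulVec X v
    rw [ht, zero_smul, zero_sub, pow_two, Matrix.SpecialLinearGroup.coe_mul, ← mulVec_mulVec] at this
    exact this
  have hMw : (M : Matrix (Fin 2) (Fin 2) ℂ) *ᵥ w = (-1 : ℂ) • w := by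
    have hc : M * X = X * M⁻¹ := by rw [← hMX]; group
    rw [hw, mulVec_mulVec, ← Matrix.SpecialLinearGroup.coe_mul, hc]
    refine coe_mul_mulVec (inv_mulVec_eigenvector hξ h) ?_
    rw [mulVec_smul]
    norm_num
  refine hirr ⟨w + I • v, ?_, ⟨-1, by simp, ?_⟩, I, ?_⟩
  · intro h0
    apply hXv (-I)
    rw [neg_smul]
    exact eq_neg_of_add_eq_zero_left h0
  · rw [mulVec_add, mulVec_smul, hMw, h, smul_add, smul_comm]
  · rw [mulVec_add, mulVec_smul, hXw, ← hw, smul_add, smul_smul, I_mul_I]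
    simp [add_comm]

lemma exists_dihedral {ξ : ℂ} {m : ℤ} (hm : ξ ^ m = -1) (hξ : ξ ≠ 0) :
    ∃ M X : SL2, X⁻¹ * M * X = M⁻¹ ∧ X ^ 2 = M ^ m ∧
      (M : Matrix (Fin 2) (Fin 2) ℂ) = !![ξ, 0; 0, ξ⁻¹] ∧
      (X : Matrix (Fin 2) (Fin 2) ℂ) = !![0, 1; -1, 0] := by
  let M : SL2 := ⟨!![ξ, 0; 0, ξ⁻¹], by simp [Matrix.det_fin_two, hξ]⟩
  let X : SL2 := ⟨!![0, 1; -1, 0], by simp [Matrix.det_fin_two]⟩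
  have hM : (M : Matrix (Fin 2) (Fin 2) ℂ) = !![ξ, 0; 0, ξ⁻¹] := rfl
  have hX : (X : Matrix (Fin 2) (Fin 2) ℂ) = !![0, 1; -1, 0] := rfl
  refine ⟨M, X, ?_, ?_, hM, hX⟩
  · rw [mul_assoc, inv_mul_eq_iff_eq_mul]
    apply Subtype.ext
    rw [Matrix.SpecialLinearGroup.coe_mul, Matrix.SpecialLinearGroup.coe_mul, Matrix.SpecialLinearGroup.coe_inv, hM, hX,
      Matrix.adjugate_fin_two]
    ext i j
    fin_cases i <;> fin_cases j <;> simp [Matrix.mul_apply]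
  · have h₀ : (M : Matrix (Fin 2) (Fin 2) ℂ) *ᵥ ![1, 0] = ξ • ![1, 0] := by
      rw [hM]; ext i; fin_cases i <;> simp
    have h₁ : (M : Matrix (Fin 2) (Fin 2) ℂ) *ᵥ ![0, 1] = ξ⁻¹ • ![0, 1] := by
      rw [hM]; ext i; fin_cases i <;> simp
    have k₀ := zpow_mulVec_eigenvector hξ h₀ m
    have k₁ := zpow_mulVec_eigenvector (inv_ne_zero hξ) h₁ m
    rw [_root_.inv_zpow] at k₁
    rw [hm] at k₀ k₁
    have a := congrFun k₀ 0
    have b := congrFun k₀ 1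
    have c := congrFun k₁ 0
    have d := congrFun k₁ 1
    simp [Matrix.mulVec, dotProduct, Fin.sum_univ_two] at a b c d
    ext i j
    rw [pow_two, Matrix.SpecialLinearGroup.coe_mul, hX]
    fin_cases i <;> fin_cases j <;> simp [a, b, c, d]

end SL2

lemma pow_natAbs_eq_neg_one_iff {ξ : ℂ} (m : ℤ) : ξ ^ m.natAbs = -1 ↔ ξ ^ m = -1 := by
  rcases Int.natAbs_eq m with h | h
  · conv_rhs => rw [h, zpow_natCast]
  · conv_rhs => rw [h, _root_.zpow_neg, zpow_natCast, inv_eq_iff_eq_inv, inv_neg, inv_one]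

lemma exp_odd_root_neg_one {p j : ℕ} (hodd : Odd p) (hj : 1 ≤ j) (hjp : j ≤ (p - 1) / 2) :
    Complex.exp (Complex.I * ((Real.pi * (2 * (j : ℝ) - 1) / (p : ℝ) : ℝ) : ℂ)) ^ p = -1 ∧
    Complex.exp (Complex.I * ((Real.pi * (2 * (j : ℝ) - 1) / (p : ℝ) : ℝ) : ℂ)) ≠ -1 := by
  have hp : p ≠ 0 := hodd.pos.ne'
  have hpc : (p : ℂ) ≠ 0 := by exact_mod_cast hp
  constructor
  · rw [← Complex.exp_nat_mul]
    have : (p : ℂ) * (Complex.I * ((Real.pi * (2 * (j : ℝ) - 1) / (p : ℝ) : ℝ) : ℂ)) =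
        j * (2 * Real.pi * Complex.I) - Real.pi * Complex.I := by
      push_cast
      field_simp
    rw [this, Complex.exp_sub, Complex.exp_nat_mul_two_pi_mul_I, Complex.exp_pi_mul_I]
    norm_num
  · rw [← Complex.exp_pi_mul_I, Ne, Complex.exp_eq_exp_iff_exists_int]
    rintro ⟨k, hk⟩
    have hπ : (Real.pi : ℂ) ≠ 0 := by exact_mod_cast Real.pi_ne_zero
    have hI := Complex.I_ne_zero
    push_cast at hk
    field_simp at hk
    have hz : (2 * (j : ℤ) - 1) = p * (1 + 2 * k) := by
      exact_mod_cast (by linear_combination hk : (2 * (j : ℂ) - 1) = p * (1 + 2 * k))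
    have hlt : (2 * (j : ℤ) - 1) < p := by omega
    have hpos : 0 < (2 * (j : ℤ) - 1) := by omega
    have hp0 : (0 : ℤ) < p := by omega
    have : 0 < 1 + 2 * k := by
      rw [hz] at hpos
      exact pos_of_mul_pos_right hpos hp0.le
    nlinarith

lemma eq_exp_of_odd_root_neg_one {p : ℕ} (hodd : Odd p) {ξ : ℂ} (h : ξ ^ p = -1) (hξ : ξ ≠ -1) :
    ∃ j : ℕ, 1 ≤ j ∧ j ≤ (p - 1) / 2 ∧
      (ξ = Complex.exp (Complex.I * ((Real.pi * (2 * (j : ℝ) - 1) / (p : ℝ) : ℝ) : ℂ)) ∨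
       ξ = Complex.exp (-Complex.I * ((Real.pi * (2 * (j : ℝ) - 1) / (p : ℝ) : ℝ) : ℂ))) := by
  have hp : p ≠ 0 := hodd.pos.ne'
  have hpc : (p : ℂ) ≠ 0 := by exact_mod_cast hp
  have : NeZero p := ⟨hp⟩
  have h1 : (-ξ) ^ p = 1 := by rw [hodd.neg_pow, h, neg_neg]
  obtain ⟨k, hk, hkξ⟩ := (Complex.isPrimitiveRoot_exp p hp).eq_pow_of_pow_eq_one h1
  rw [← Complex.exp_nat_mul] at hkξ
  have hk0 : k ≠ 0 := by
    rintro rfl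
    apply hξ
    simp at hkξ
    rw [hkξ, neg_neg]
  obtain ⟨q, hq⟩ := hodd
  have hξ' : ξ = Complex.exp (k * (2 * Real.pi * Complex.I / p) - Real.pi * Complex.I) := by
    rw [Complex.exp_sub, Complex.exp_pi_mul_I, hkξ]
    simp
  have hpq : (p : ℂ) = 2 * q + 1 := by exact_mod_cast hq
  by_cases hkq : k ≤ q
  · refine ⟨q + 1 - k, by omega, by omega, Or.inr ?_⟩
    rw [hξ']
    congr 1
    push_cast [Nat.cast_sub (show k ≤ q + 1 by omega)]
    field_simp
    rw [hpq]
    ring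
  · refine ⟨k - q, by omega, by omega, Or.inl ?_⟩
    rw [hξ']
    congr 1
    push_cast [Nat.cast_sub (show q ≤ k by omega)]
    field_simp
    rw [hpq]
    ring

theorem set_of_meridian_eigenvalues (n : ℤ) (hn0 : n ≠ 0) (hn1 : n ≠ -1)
    (p : ℕ) (hp : p = (4 * n + 1).natAbs) :
    {ξ : ℂ | ∃ A B X Y : SL2,
        A ^ 2 = B ^ (2 * n + 1) ∧
        X⁻¹ * Y * X = Y⁻¹ ∧
        B ^ (-n) * A = Y⁻¹ ∧
        A ^ 2 = Y⁻¹ * X ^ 2 ∧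
        IrredQuad A B X Y ∧
        ∃ v : Fin 2 → ℂ, v ≠ 0 ∧
          ((B ^ (-n) * A : SL2) : Matrix (Fin 2) (Fin 2) ℂ) *ᵥ v = ξ • v} =
    {ξ : ℂ | ∃ j : ℕ, 1 ≤ j ∧ j ≤ (p - 1) / 2 ∧
        (ξ = Complex.exp (Complex.I * ((Real.pi * (2 * (j : ℝ) - 1) / (p : ℝ) : ℝ) : ℂ)) ∨
         ξ = Complex.exp (-Complex.I * ((Real.pi * (2 * (j : ℝ) - 1) / (p : ℝ) : ℝ) : ℂ)))} := by
  have hodd : Odd p := by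
    rw [hp, Int.natAbs_odd]
    exact ⟨2 * n, by ring⟩
  ext ξ
  constructor
  · rintro ⟨A, B, X, Y, hAB, hXY, hM, hH, hirr, v, hv, hξ⟩
    have hc := SL2.commute_of_relations hAB hXY hM hH
    obtain ⟨M, rfl⟩ : ∃ M, Y = M⁻¹ := ⟨Y⁻¹, (inv_inv Y).symm⟩
    rw [inv_inv] at hXY hM hH
    have hBM : B = M ^ 2 := by
      rw [← hM, (hc.symm.zpow_left (-n)).mul_pow, hAB, ← zpow_natCast, ← _root_.zpow_mul, ← _root_.zpow_add]
      ring_nf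
      rw [zpow_one]
    have hAM : A = M ^ (2 * n + 1) := by
      have : A = B ^ n * M := by rw [← hM]; group
      rw [this, hBM, ← zpow_natCast, ← _root_.zpow_mul, _root_.zpow_add_one]
      norm_num
    have hX : X ^ 2 = M ^ (4 * n + 1) := by
      have : X ^ 2 = M⁻¹ * A ^ 2 := by rw [hH]; group
      rw [this, hAM, ← zpow_natCast, ← _root_.zpow_mul, ← _root_.zpow_neg_one, ← _root_.zpow_add]
      congr 1
      push_cast
      ring
    rw [hM] at hξ
    have hMX : X⁻¹ * M * X = M⁻¹ := by
      have : X⁻¹ * M * X = (X⁻¹ * M⁻¹ * X)⁻¹ := by group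
      rw [this, hXY]
    obtain ⟨h₁, h₂⟩ := SL2.eigenvalue_of_dihedral hMX hX (by
      rintro ⟨u, hu, ⟨c, hc0, hMu⟩, hXu⟩
      refine hirr ⟨u, hu, ⟨c ^ (2 * n + 1), ?_⟩, ⟨c ^ 2, ?_⟩, hXu, ⟨_, SL2.inv_mulVec_eigenvector hc0 hMu⟩⟩
      · rw [hAM]
        exact SL2.zpow_mulVec_eigenvector hc0 hMu _
      · rw [hBM]
        exact SL2.pow_mulVec_eigenvector hMu _) hv hξ
    refine eq_exp_of_odd_root_neg_one hodd ?_ h₂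
    rwa [hp, pow_natAbs_eq_neg_one_iff]
  · rintro ⟨j, hj, hjp, hξ⟩
    have hroot : ξ ^ p = -1 ∧ ξ ≠ -1 := by
      obtain ⟨h₁, h₂⟩ := exp_odd_root_neg_one hodd hj hjp
      rcases hξ with rfl | rfl
      · exact ⟨h₁, h₂⟩
      · rw [neg_mul, Complex.exp_neg, inv_pow, h₁]
        refine ⟨by norm_num, fun h => h₂ ?_⟩
        rw [inv_eq_iff_eq_inv] at h
        rw [h]
        norm_num
    obtain ⟨hpow, hne⟩ := hroot
    have hξ0 : ξ ≠ 0 := by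
      rintro rfl
      simp [hodd.pos.ne'] at hpow
    have hm : ξ ^ (4 * n + 1) = -1 := by rwa [hp, pow_natAbs_eq_neg_one_iff] at hpow
    obtain ⟨M, X, hMX, hX, hMc, hXc⟩ := SL2.exists_dihedral hm hξ0
    have hBnA : (M ^ 2) ^ (-n) * M ^ (2 * n + 1) = M := by
      rw [← zpow_natCast, ← _root_.zpow_mul, ← _root_.zpow_add]
      convert zpow_one M using 2
      push_cast
      ring
    refine ⟨M ^ (2 * n + 1), M ^ 2, X, M⁻¹, ?_, ?_, ?_, ?_, ?_, ![1, 0], by simp, ?_⟩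
    · rw [← zpow_natCast, ← zpow_natCast, ← _root_.zpow_mul, ← _root_.zpow_mul, mul_comm]
    · have : X⁻¹ * M⁻¹ * X = (X⁻¹ * M * X)⁻¹ := by group
      rw [this, hMX]
    · rw [hBnA, inv_inv]
    · rw [hX, inv_inv, ← zpow_natCast, ← _root_.zpow_mul, ← _root_.zpow_one_add]
      congr 1
      push_cast
      ring
    · rintro ⟨v, hv, -, -, ⟨c, hc⟩, d, hd⟩
      rw [Matrix.SpecialLinearGroup.coe_inv, hMc, Matrix.adjugate_fin_two] at hd
      rw [hXc] at hc
      have hc₀ := congrFun hc 0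
      have hc₁ := congrFun hc 1
      have hd₀ := congrFun hd 0
      have hd₁ := congrFun hd 1
      simp [Matrix.mulVec, dotProduct, Fin.sum_univ_two] at hc₀ hc₁ hd₀ hd₁
      have hv₀ : v 0 ≠ 0 := by
        intro h0
        apply hv
        ext i
        fin_cases i <;> simp [h0, hc₀]
      have hv₁ : v 1 ≠ 0 := by
        intro h1
        rw [h1, mul_zero, neg_eq_zero] at hc₁
        exact hv₀ hc₁
      have hξ2 : ξ = ξ⁻¹ := by
        rcases hd₀ with hd₀ | hd₀
        · rcases hd₁ with hd₁ | hd₁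
          · rw [hd₀, hd₁]
          · exact absurd hd₁ hv₁
        · exact absurd hd₀ hv₀
      rcases mul_self_eq_one_iff.mp (by
        nth_rewrite 2 [hξ2]
        exact mul_inv_cancel₀ hξ0 : ξ * ξ = 1) with h | h
      · rw [h, one_pow] at hpow
        norm_num at hpow
      · exact hne h
    · rw [hBnA, hMc]
      ext i
      fin_cases i <;> simp
end
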